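/- Suppose l(p) = 0 and l'(p) = 0. Then γ''(p) = 0, and det(γ'''(p), γ⁽⁴⁾(p)) ≠ 0 if and only if η'(p)·l''(p) ≠ 0. (By the cusp criterion, this says γ has a 4/3-cusp at p if and only if η'(p)·l''(p) ≠ 0.) -/

import Mathlib

open Real

/-- Rotation of the plane by angle `θ`. -/
noncomputable def rot (θ : ℝ) (v : ℝ × ℝ) : ℝ × ℝ :=
  (Real.cos θ * v.1 - Real.sin θ * v.2, Real.sin θ * v.1 + Real.cos θ * v.2)

/-- Determinant of the 2×2 matrix with columns `v`, `w`. -/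
def det2 (v w : ℝ × ℝ) : ℝ := v.1 * w.2 - v.2 * w.1

open scoped ContDiff

theorem hasDerivAt_of_eq_integral {f g : ℝ → ℝ} (hg : Continuous g)
    (hf : ∀ t, f t = ∫ u in (0:ℝ)..t, g u) (t : ℝ) : HasDerivAt f (g t) t := by
  rw [funext hf]
  exact hg.integral_hasStrictDerivAt 0 t |>.hasDerivAt

theorem contDiff_of_hasDerivAt {E : Type*} [NormedAddCommGroup E] [NormedSpace ℝ E]
    {f f' : ℝ → E} (hf' : ContDiff ℝ ∞ f') (hf : ∀ t, HasDerivAt f (f' t) t) :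
    ContDiff ℝ ∞ f := by
  rw [contDiff_infty_iff_deriv, funext fun t => (hf t).deriv]
  exact ⟨fun t => (hf t).differentiableAt, hf'⟩

/-- Derivatives of a curve with velocity `l • V` at a point where `l` vanishes to second order. -/
theorem iteratedDeriv_of_hasDerivAt_smul {E : Type*} [NormedAddCommGroup E] [NormedSpace ℝ E]
    {l : ℝ → ℝ} {γ V : ℝ → E} (hl : ContDiff ℝ ∞ l) (hV : ContDiff ℝ ∞ V)
    (hγ : ∀ t, HasDerivAt γ (l t • V t) t) {p : ℝ} (hlp : l p = 0) (hl' : deriv l p = 0) :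
    iteratedDeriv 2 γ p = 0 ∧ iteratedDeriv 3 γ p = iteratedDeriv 2 l p • V p ∧
      iteratedDeriv 4 γ p =
        iteratedDeriv 3 l p • V p + (3 * iteratedDeriv 2 l p) • deriv V p := by
  have deriv_smul_eq {a : ℝ → ℝ} {W : ℝ → E} (ha : ContDiff ℝ ∞ a) (hW : ContDiff ℝ ∞ W) :
      deriv (a • W) = a • deriv W + deriv a • W :=
    funext fun t => deriv_smul (ha.differentiable (by simp) t) (hW.differentiable (by simp) t)
  have deriv_add_eq {A B : ℝ → E} (hA : ContDiff ℝ ∞ A) (hB : ContDiff ℝ ∞ B) :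
      deriv (A + B) = deriv A + deriv B :=
    funext fun t => deriv_add (hA.differentiable (by simp) t) (hB.differentiable (by simp) t)
  have contDiff_add {A B : ℝ → E} (hA : ContDiff ℝ ∞ A) (hB : ContDiff ℝ ∞ B) : ContDiff ℝ ∞ (A + B) :=
    hA.add hB
  have l₁ := (contDiff_infty_iff_deriv.1 hl).2
  have l₂ := (contDiff_infty_iff_deriv.1 l₁).2
  have V₁ := (contDiff_infty_iff_deriv.1 hV).2
  have V₂ := (contDiff_infty_iff_deriv.1 V₁).2
  have d₁ : deriv γ = l • V := funext fun t => (hγ t).deriv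
  have d₂ : deriv (deriv γ) = l • deriv V + deriv l • V := by rw [d₁, deriv_smul_eq hl hV]
  have d₃ : deriv (deriv (deriv γ)) = l • deriv (deriv V) + deriv l • deriv V +
      (deriv l • deriv V + deriv (deriv l) • V) := by
    rw [d₂, deriv_add_eq (hl.smul V₁) (l₁.smul hV), deriv_smul_eq hl V₁, deriv_smul_eq l₁ hV]
  have d₄ : deriv (deriv (deriv (deriv γ))) =
      l • deriv (deriv (deriv V)) + deriv l • deriv (deriv V) +
      (deriv l • deriv (deriv V) + deriv (deriv l) • deriv V) +
      (deriv l • deriv (deriv V) + deriv (deriv l) • deriv V +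
      (deriv (deriv l) • deriv V + deriv (deriv (deriv l)) • V)) := by
    rw [d₃, deriv_add_eq (contDiff_add (hl.smul V₂) (l₁.smul V₁)) (contDiff_add (l₁.smul V₁) (l₂.smul hV)),
      deriv_add_eq (hl.smul V₂) (l₁.smul V₁), deriv_add_eq (l₁.smul V₁) (l₂.smul hV),
      deriv_smul_eq hl V₂, deriv_smul_eq l₁ V₁, deriv_smul_eq l₂ hV]
  simp only [iteratedDeriv_eq_iterate, Function.iterate_succ_apply, Function.iterate_zero_apply]
  rw [d₄, d₃, d₂]
  simp only [Pi.add_apply, Pi.smul_apply', hlp, hl', zero_smul, zero_add, add_zero, true_and]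
  module

/-- Criterion for a 4/3-cusp of `γ` at a singular point `p` with `l'(p) = 0`:
`det(γ'''(p), γ⁗(p)) ≠ 0` iff `η'(p) l''(p) ≠ 0`. -/
theorem cusp_43_criterion
    (l h : ℝ → ℝ) (hl : ContDiff ℝ (⊤ : ℕ∞) l) (hh : ContDiff ℝ (⊤ : ℕ∞) h)
    (η F G : ℝ → ℝ)
    (hη : ∀ u, η u = ∫ v in (0:ℝ)..u, 2 * h v)
    (hF : ∀ t, F t = ∫ u in (0:ℝ)..t, l u * sin (η u))
    (hG : ∀ t, G t = ∫ u in (0:ℝ)..t, l u * cos (η u))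
    (c₁ c₂ : ℝ)
    (hpos : ∀ t, 0 < (F t - c₁) ^ 2 + (G t - c₂) ^ 2)
    (y x : ℝ → ℝ)
    (hy : ∀ t, y t = Real.sqrt ((F t - c₁) ^ 2 + (G t - c₂) ^ 2))
    (hx : ∀ t, x t = ∫ u in (0:ℝ)..t,
      (deriv F u * (G u - c₂) - deriv G u * (F u - c₁)) / y u)
    (γ : ℝ → ℝ × ℝ) (hγ : ∀ t, γ t = (x t, y t))
    (U : ℝ → ℝ × ℝ) (hU : ∀ t, U t = (-(F t - c₁), G t - c₂))
    (p : ℝ) (hlp : l p = 0) (hl' : deriv l p = 0) :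
    iteratedDeriv 2 γ p = 0 ∧
    (det2 (iteratedDeriv 3 γ p) (iteratedDeriv 4 γ p) ≠ 0 ↔
      deriv η p * iteratedDeriv 2 l p ≠ 0) := by
  have hηd := hasDerivAt_of_eq_integral (by fun_prop) hη
  have hηs : ContDiff ℝ ∞ η := contDiff_of_hasDerivAt (by fun_prop) hηd
  have hFd := hasDerivAt_of_eq_integral (by fun_prop) hF
  have hFs : ContDiff ℝ ∞ F := contDiff_of_hasDerivAt (by fun_prop) hFd
  have hGd := hasDerivAt_of_eq_integral (by fun_prop) hG
  have hGs : ContDiff ℝ ∞ G := contDiff_of_hasDerivAt (by fun_prop) hGd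
  have hypos (t) : 0 < y t := hy t ▸ Real.sqrt_pos.2 (hpos t)
  have hysq (t) : y t ^ 2 = (F t - c₁) ^ 2 + (G t - c₂) ^ 2 := by
    rw [hy, Real.sq_sqrt (hpos t).le]
  have hys : ContDiff ℝ ∞ y := by
    rw [funext hy]
    exact ContDiff.sqrt (by fun_prop) fun t => (hpos t).ne'
  let a : ℝ → ℝ := fun t => (sin (η t) * (G t - c₂) - cos (η t) * (F t - c₁)) / y t
  let b : ℝ → ℝ := fun t => (sin (η t) * (F t - c₁) + cos (η t) * (G t - c₂)) / y t
  have has : ContDiff ℝ ∞ a := ContDiff.div (by fun_prop) hys fun t => (hypos t).ne'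
  have hbs : ContDiff ℝ ∞ b := ContDiff.div (by fun_prop) hys fun t => (hypos t).ne'
  have hxd (t) : HasDerivAt x (l t * a t) t := by
    refine hasDerivAt_of_eq_integral (g := fun t => l t * a t)
      (hl.continuous.mul has.continuous) (fun t => ?_) t
    rw [hx]
    congr 1 with u
    rw [(hFd u).deriv, (hGd u).deriv]
    simp only [a]
    ring
  have hyd (t) : HasDerivAt y (l t * b t) t := by
    have hs := ((((hFd t).sub_const c₁).fun_pow 2).fun_add
      (((hGd t).sub_const c₂).fun_pow 2)).sqrt (hpos t).ne'
    rw [← hy, ← funext hy] at hs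
    convert hs using 1
    have := (hypos t).ne'
    simp only [b]
    field_simp
    ring
  have hγd (t) : HasDerivAt γ (l t • (a t, b t)) t := by
    rw [funext hγ]
    exact (hxd t).prodMk (hyd t)
  obtain ⟨h2, h3, h4⟩ := iteratedDeriv_of_hasDerivAt_smul hl (has.prodMk hbs) hγd hlp hl'
  have hFp : HasDerivAt F 0 p := by simpa [hlp] using hFd p
  have hGp : HasDerivAt G 0 p := by simpa [hlp] using hGd p
  have hyp : HasDerivAt y 0 p := by simpa [hlp] using hyd p
  have hηp := (hηs.differentiable (by simp) p).hasDerivAt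
  have hy0 := (hypos p).ne'
  have hap : HasDerivAt a (deriv η p * b p) p := by
    refine (((hηp.sin.mul (hGp.sub_const c₂)).sub
      (hηp.cos.mul (hFp.sub_const c₁))).div hyp hy0).congr_deriv ?_
    simp only [b]
    field_simp
    ring
  have hbp : HasDerivAt b (-(deriv η p * a p)) p := by
    refine (((hηp.sin.mul (hFp.sub_const c₁)).add
      (hηp.cos.mul (hGp.sub_const c₂))).div hyp hy0).congr_deriv ?_
    simp only [a]
    field_simp
    ring
  have hab : a p ^ 2 + b p ^ 2 = 1 := by
    simp only [a, b]
    field_simp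
    rw [hysq]
    linear_combination ((F p - c₁) ^ 2 + (G p - c₂) ^ 2) * sin_sq_add_cos_sq (η p)
  have hdet : det2 (iteratedDeriv 3 γ p) (iteratedDeriv 4 γ p) =
      -3 * iteratedDeriv 2 l p ^ 2 * deriv η p := by
    rw [h3, h4, (hap.prodMk hbp).deriv]
    simp only [det2, Prod.smul_fst, Prod.smul_snd, Prod.fst_add, Prod.snd_add, smul_eq_mul]
    linear_combination (-3 * iteratedDeriv 2 l p ^ 2 * deriv η p) * hab
  refine ⟨h2, ?_⟩
  rw [hdet]
  simp [and_comm]
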